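/- arXiv:2005.12243 — 3 statements merged into one kernel-verified Lean document; each statement's English description precedes it below -/
import Mathlib

section
/- There exists an absolute constant C ≥ 1 such that for every integer d ≥ 2 and every ε ∈ (0, 1/2] with ε ≤ exp(-d), one has N(ε, d) ≤ (C · ln d / ε) · ln(1/ε). -/
open MeasureTheory Set

noncomputable section

/-- The unit cube `Q_d = [0,1]^d`. -/
def cube (d : ℕ) : Set (Fin d → ℝ) := Set.univ.pi fun _ => Set.Icc (0 : ℝ) 1

/-- `B` is an axis-parallel box `∏ [aᵢ, bᵢ)` contained in the unit cube. -/
def IsBox {d : ℕ} (B : Set (Fin d → ℝ)) : Prop :=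
  ∃ a b : Fin d → ℝ, (∀ i, 0 ≤ a i ∧ a i ≤ b i ∧ b i ≤ 1) ∧
    B = Set.univ.pi fun i => Set.Ico (a i) (b i)

/-- Dispersion of a point set `P ⊆ Q_d`: the supremum of volumes of boxes avoiding `P`. -/
def disp {d : ℕ} (P : Set (Fin d → ℝ)) : ℝ :=
  sSup {v : ℝ | ∃ B : Set (Fin d → ℝ), IsBox B ∧ B ∩ P = ∅ ∧ v = (volume B).toReal}

/-- Minimal dispersion `disp*(n,d)` over all `n`-point subsets of the cube. -/
def minDisp (n d : ℕ) : ℝ :=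
  sInf {v : ℝ | ∃ P : Finset (Fin d → ℝ),
    ↑P ⊆ cube d ∧ P.card = n ∧ v = disp (↑P : Set (Fin d → ℝ))}

/-- Inverse of the minimal dispersion, `N(ε,d)`. -/
def Ninv (ε : ℝ) (d : ℕ) : ℕ := sInf {n : ℕ | minDisp n d ≤ ε}

open Classical in
lemma avg_point {ι : Type*} {d : ℕ} (S : ι → Set (Fin d → ℝ)) (δ : ℝ) (D : Finset ι)
    (h : ∀ i ∈ D, MeasurableSet (S i) ∧ S i ⊆ cube d ∧ δ ≤ volume.real (S i)) :
    ∃ x ∈ cube d, δ * (D.card : ℝ) ≤ ((D.filter fun i => x ∈ S i).card : ℝ) := by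
  have hvol : volume (cube d) = 1 := by
    rw [cube, MeasureTheory.volume_pi_pi]
    simp
  have hm : MeasurableSet (cube d) := by
    unfold cube
    exact MeasurableSet.univ_pi fun _ => measurableSet_Icc
  have hfin : ∀ i ∈ D, IntegrableOn ((S i).indicator (fun _ => (1:ℝ))) (cube d) volume := by
    intro i hi
    rw [IntegrableOn, integrable_indicator_iff (h i hi).1]
    apply integrableOn_const
    · rw [Measure.restrict_apply (h i hi).1]
      exact ne_top_of_le_ne_top (by rw [hvol]; simp) (measure_mono inter_subset_right)
    · simp
  obtain ⟨x, hx, hle⟩ := exists_setAverage_le (μ := volume) (s := cube d)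
    (f := fun x => ∑ i ∈ D, (S i).indicator (fun _ => (1:ℝ)) x)
    (by rw [hvol]; simp) (by rw [hvol]; simp) (integrable_finsetSum D hfin)
  refine ⟨x, hx, ?_⟩
  rw [setAverage_eq, integral_finsetSum D hfin] at hle
  have h1 : ∀ i ∈ D, δ ≤ ∫ a in cube d, (S i).indicator (fun _ => (1:ℝ)) a := by
    intro i hi
    rw [integral_indicator_const _ (h i hi).1, measureReal_restrict_apply (h i hi).1,
      inter_eq_left.2 (h i hi).2.1]
    simpa using (h i hi).2.2
  have h2 := Finset.card_nsmul_le_sum D _ δ h1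
  have h3 : volume.real (cube d) = 1 := by simp [Measure.real, hvol]
  rw [h3] at hle
  have h4 : ∑ i ∈ D, (S i).indicator (fun _ => (1:ℝ)) x = ((D.filter fun i => x ∈ S i).card : ℝ) := by
    simp [Set.indicator_apply, Finset.sum_ite]
  rw [h4] at hle
  simp only [nsmul_eq_mul, inv_one, one_smul] at h2 hle
  linarith

open Classical in
lemma greedy {ι : Type*} {d : ℕ} (S : ι → Set (Fin d → ℝ)) (δ : ℝ) (hδ : δ ≤ 1) (n : ℕ) :
    ∀ D : Finset ι,
    (∀ i ∈ D, MeasurableSet (S i) ∧ S i ⊆ cube d ∧ δ ≤ volume.real (S i)) →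
    (D.card : ℝ) * (1 - δ) ^ n < 1 →
    ∃ P : Finset (Fin d → ℝ), (↑P : Set (Fin d → ℝ)) ⊆ cube d ∧ P.card ≤ n ∧
      ∀ i ∈ D, ∃ x ∈ P, x ∈ S i := by
  induction n with
  | zero =>
    intro D _ hc
    have : D.card < 1 := by simpa using hc
    have : D = ∅ := by simpa using this
    exact ⟨∅, by simp, by simp, by simp [this]⟩
  | succ n ih =>
    intro D h hc
    obtain ⟨x, hx, hle⟩ := avg_point S δ D h
    obtain ⟨P, hP, hPc, hPi⟩ := ih (D.filter fun i => ¬ x ∈ S i)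
      (fun i hi => h i (Finset.mem_filter.1 hi).1) (by
        have h1 := Finset.card_filter_add_card_filter_not (s := D) (fun i => x ∈ S i)
        have h2 : ((D.filter fun i => x ∈ S i).card : ℝ) +
          ((D.filter fun i => ¬ x ∈ S i).card : ℝ) = D.card := by exact_mod_cast h1
        have h3 : ((D.filter fun i => ¬ x ∈ S i).card : ℝ) ≤ D.card * (1 - δ) := by linarith
        calc _ ≤ (D.card * (1 - δ)) * (1 - δ) ^ n :=
              mul_le_mul_of_nonneg_right h3 (pow_nonneg (by linarith) _)
          _ < 1 := by rw [pow_succ] at hc; linarith)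
    refine ⟨insert x P, ?_, ?_, ?_⟩
    · intro y hy
      rcases Finset.mem_insert.1 (Finset.mem_coe.1 hy) with rfl | hy
      · exact hx
      · exact hP hy
    · exact (Finset.card_insert_le _ _).trans (by omega)
    · intro i hi
      by_cases hxi : x ∈ S i
      · exact ⟨x, Finset.mem_insert_self _ _, hxi⟩
      · obtain ⟨y, hy, hyi⟩ := hPi i (Finset.mem_filter.2 ⟨hi, hxi⟩)
        exact ⟨y, Finset.mem_insert_of_mem hy, hyi⟩

/-- One-dimensional approximation. -/
lemma approx1 (d : ℕ) (hd : 1 ≤ d) (a b : ℝ) (ha : 0 ≤ a) (hab : a < b) (hb : b ≤ 1) :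
    ∃ k j m : ℕ, (2:ℝ) ^ k * (b - a) ≤ 1 ∧ j ≤ 8 * d * 2 ^ k ∧ m ≤ 8 * d ∧
      a ≤ (j : ℝ) / (8 * d * 2 ^ k) ∧ ((j + m : ℕ) : ℝ) / (8 * d * 2 ^ k) ≤ b ∧
      (b - a) * (1 - 1 / (2 * d)) ≤ ((j + m : ℕ) : ℝ) / (8 * d * 2 ^ k) - (j : ℝ) / (8 * d * 2 ^ k) := by
  obtain ⟨k, hk1, hk2⟩ := exists_nat_pow_near_of_lt_one (x := b - a) (y := (1/2 : ℝ))
    (by linarith) (by linarith) (by norm_num) (by norm_num)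
  have hd' : (1:ℝ) ≤ d := by exact_mod_cast hd
  have hp : (0:ℝ) < 2 ^ k := by positivity
  rw [one_div, inv_pow] at hk1 hk2
  have hk2' : (2:ℝ) ^ k * (b - a) ≤ 1 := by
    have := mul_le_mul_of_nonneg_left hk2 hp.le
    rwa [mul_inv_cancel₀ hp.ne'] at this
  have hk1' : 1 < (2:ℝ) ^ k * (b - a) * 2 := by
    have := mul_lt_mul_of_pos_left hk1 (show (0:ℝ) < 2 ^ (k+1) by positivity)
    rw [mul_inv_cancel₀ (by positivity), pow_succ] at this
    linarith
  obtain ⟨T, hT⟩ : ∃ T : ℝ, T = 8 * d * 2 ^ k := ⟨_, rfl⟩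
  have hTp : 0 < T := by rw [hT]; positivity
  have hj1 := Nat.le_ceil (a * T)
  have hj2 := Nat.ceil_lt_add_one (show 0 ≤ a * T by positivity)
  have he1 := Nat.floor_le (show 0 ≤ b * T from mul_nonneg (by linarith) hTp.le)
  have he2 := Nat.lt_floor_add_one (b * T)
  obtain ⟨j, hj⟩ : ∃ j, j = ⌈a * T⌉₊ := ⟨_, rfl⟩
  obtain ⟨e, he⟩ : ∃ e, e = ⌊b * T⌋₊ := ⟨_, rfl⟩
  rw [← hj] at hj1 hj2
  rw [← he] at he1 he2
  have hlen : (b - a) * T * (1 - 1 / (2 * d)) ≤ (b - a) * T - 2 := by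
    have : (b - a) * T * (1 / (2 * d)) = 4 * (2 ^ k * (b - a)) := by
      rw [hT]; field_simp; ring
    nlinarith
  have hpos : 0 ≤ (b - a) * T * (1 - 1 / (2 * d)) := by
    apply mul_nonneg (mul_nonneg (by linarith) hTp.le)
    rw [sub_nonneg, div_le_one (by positivity)]; linarith
  have hje : j ≤ e := by
    have : (j:ℝ) ≤ e := by linarith
    exact_mod_cast this
  refine ⟨k, j, e - j, hk2', ?_, ?_, ?_, ?_, ?_⟩
  · rw [hj, Nat.ceil_le]; push_cast; rw [← hT]; nlinarith
  · have h1 : ((e - j : ℕ):ℝ) ≤ (8 * d : ℕ) := by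
      rw [Nat.cast_sub hje]; push_cast
      have : (b - a) * T ≤ 8 * d := by
        rw [hT]; nlinarith
      linarith
    exact_mod_cast h1
  · rw [← hT, le_div_iff₀ hTp]; exact hj1
  · rw [← hT, Nat.add_sub_cancel' hje, div_le_iff₀ hTp]; exact he1
  · rw [← hT, Nat.add_sub_cancel' hje, ← sub_div, le_div_iff₀ hTp]; linarith

/-- The net box. -/
def netBox (d : ℕ) (q : Σ _ : (Fin d → ℕ), (Fin d → ℕ × ℕ)) : Set (Fin d → ℝ) :=
  Set.univ.pi fun i => Set.Ico (((q.2 i).1 : ℝ) / (8 * d * 2 ^ q.1 i))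
    ((((q.2 i).1 + (q.2 i).2 : ℕ) : ℝ) / (8 * d * 2 ^ q.1 i))

open Classical in
def netK (d K : ℕ) (ε : ℝ) : Finset (Fin d → ℕ) :=
  (Fintype.piFinset fun _ : Fin d => Finset.range K).filter fun k => ε * ∏ i, (2:ℝ) ^ k i ≤ 1

def net (d K : ℕ) (ε : ℝ) : Finset (Σ _ : (Fin d → ℕ), (Fin d → ℕ × ℕ)) :=
  (netK d K ε).sigma fun k => Fintype.piFinset fun i =>
    Finset.range (8 * d * 2 ^ k i + 1) ×ˢ Finset.range (8 * d + 1)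

lemma net_card (d K : ℕ) (hd : 1 ≤ d) (ε : ℝ) (hε : 0 < ε) :
    ((net d K ε).card : ℝ) ≤ (K:ℝ) ^ d * ((81 * (d:ℝ) ^ 2) ^ d * (1 / ε)) := by
  have hd' : (1:ℝ) ≤ d := by exact_mod_cast hd
  rw [net, Finset.card_sigma]
  push_cast
  have h1 : ∀ k ∈ netK d K ε, (((Fintype.piFinset fun i =>
    Finset.range (8 * d * 2 ^ k i + 1) ×ˢ Finset.range (8 * d + 1)).card : ℕ) : ℝ)
      ≤ (81 * (d:ℝ) ^ 2) ^ d * (1 / ε) := by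
    intro k hk
    rw [Fintype.card_piFinset]
    push_cast
    have hk2 := (Finset.mem_filter.1 hk).2
    calc _ ≤ ∏ i : Fin d, (81 * (d:ℝ) ^ 2 * 2 ^ k i) := by
          apply Finset.prod_le_prod
          · intros; positivity
          · intro i _
            rw [Finset.card_product, Finset.card_range, Finset.card_range]
            push_cast
            have : (1:ℝ) ≤ 2 ^ k i := one_le_pow₀ (by norm_num)
            have h3 : (8 * (d:ℝ) * 2 ^ k i + 1) ≤ 9 * d * 2 ^ k i := by nlinarith
            have h4 : (8 * (d:ℝ) + 1) ≤ 9 * d := by linarith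
            calc _ ≤ (9 * d * 2 ^ k i) * (9 * (d:ℝ)) := by gcongr
              _ = _ := by ring
      _ = (81 * (d:ℝ) ^ 2) ^ d * ∏ i : Fin d, (2:ℝ) ^ k i := by
          rw [Finset.prod_mul_distrib]; simp
      _ ≤ _ := by
          apply mul_le_mul_of_nonneg_left _ (by positivity)
          rw [le_div_iff₀ hε]; linarith
  calc _ ≤ ∑ k ∈ netK d K ε, (81 * (d:ℝ) ^ 2) ^ d * (1 / ε) := Finset.sum_le_sum h1
    _ = ((netK d K ε).card : ℝ) * ((81 * (d:ℝ) ^ 2) ^ d * (1 / ε)) := by simp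
    _ ≤ _ := by
      apply mul_le_mul_of_nonneg_right _ (by positivity)
      have : (netK d K ε).card ≤ K ^ d := by
        refine (Finset.card_filter_le _ _).trans ?_
        simp
      exact_mod_cast this

lemma net_approx (d K : ℕ) (hd : 1 ≤ d) (ε : ℝ) (hε : 0 < ε)
    (hK : ∀ k : ℕ, ε * 2 ^ k ≤ 1 → k < K) (B : Set (Fin d → ℝ)) (hB : IsBox B)
    (hv : ε < (volume B).toReal) :
    ∃ q ∈ net d K ε, netBox d q ⊆ B ∧ netBox d q ⊆ cube d ∧ ε / 2 ≤ volume.real (netBox d q) := by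
  obtain ⟨a, b, hab, rfl⟩ := hB
  have hd' : (1:ℝ) ≤ d := by exact_mod_cast hd
  rw [Real.volume_pi_Ico_toReal (fun i => (hab i).2.1)] at hv
  have hlt : ∀ i, a i < b i := by
    intro i
    refine lt_of_le_of_ne (hab i).2.1 fun h => ?_
    have : ∏ i, (b i - a i) = 0 := Finset.prod_eq_zero (Finset.mem_univ i) (by rw [h]; ring)
    linarith
  choose k j m h1 h2 h3 h4 h5 h6 using fun i =>
    approx1 d hd (a i) (b i) (hab i).1 (hlt i) (hab i).2.2
  have hprod : ε * ∏ i, (2:ℝ) ^ k i ≤ 1 := by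
    calc _ ≤ (∏ i, (b i - a i)) * ∏ i, (2:ℝ) ^ k i := by gcongr
      _ = ∏ i, ((2:ℝ) ^ k i * (b i - a i)) := by rw [← Finset.prod_mul_distrib]; simp_rw [mul_comm]
      _ ≤ 1 := Finset.prod_le_one
          (fun i _ => mul_nonneg (by positivity) (by linarith [hlt i])) (fun i _ => h1 i)
  have hsub : netBox d ⟨k, fun i => (j i, m i)⟩ ⊆ Set.univ.pi fun i => Set.Ico (a i) (b i) :=
    Set.pi_mono fun i _ => Set.Ico_subset_Ico (h4 i) (h5 i)
  refine ⟨⟨k, fun i => (j i, m i)⟩, ?_, hsub, ?_, ?_⟩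
  · rw [net, Finset.mem_sigma]
    constructor
    · rw [netK, Finset.mem_filter, Fintype.mem_piFinset]
      refine ⟨fun i => Finset.mem_range.2 (hK _ ?_), hprod⟩
      refine le_trans ?_ hprod
      apply mul_le_mul_of_nonneg_left _ hε.le
      rw [Finset.prod_pow_eq_pow_sum]
      exact pow_le_pow_right₀ (by norm_num)
        (Finset.single_le_sum (f := k) (fun _ _ => Nat.zero_le _) (Finset.mem_univ i))
    · rw [Fintype.mem_piFinset]
      intro i
      simp only [Finset.mem_product, Finset.mem_range]
      exact ⟨Nat.lt_succ_of_le (h2 i), Nat.lt_succ_of_le (h3 i)⟩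
  · refine hsub.trans (Set.pi_mono fun i _ => ?_)
    exact fun x hx => ⟨(hab i).1.trans hx.1, hx.2.le.trans (hab i).2.2⟩
  · have hc : 0 ≤ 1 - 1 / (2 * (d:ℝ)) := by
      rw [sub_nonneg, div_le_one (by positivity)]; linarith
    rw [Measure.real, netBox, Real.volume_pi_Ico_toReal]
    · calc ε / 2 ≤ (∏ i, (b i - a i)) * (1 - 1 / (2 * (d:ℝ))) ^ d := by
            have : (1/2:ℝ) ≤ (1 - 1 / (2 * (d:ℝ))) ^ d := by
              have := one_add_mul_le_pow (a := -(1 / (2 * (d:ℝ)))) (by linarith) d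
              have h7 : (d:ℝ) * -(1 / (2 * (d:ℝ))) = -(1/2) := by field_simp
              rw [h7] at this
              rw [sub_eq_add_neg]; linarith
            nlinarith
        _ = ∏ i, ((b i - a i) * (1 - 1 / (2 * (d:ℝ)))) := by
            rw [Finset.prod_mul_distrib]; simp
        _ ≤ _ := Finset.prod_le_prod
            (fun i _ => mul_nonneg (by linarith [hlt i]) hc) (fun i _ => h6 i)
    · intro i
      have := h6 i
      have h8 : 0 ≤ (b i - a i) * (1 - 1 / (2 * (d:ℝ))) := mul_nonneg (by linarith [hlt i]) hc
      simp only
      linarith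

lemma disp_nonneg {d : ℕ} (P : Set (Fin d → ℝ)) : 0 ≤ disp P := by
  apply Real.sSup_nonneg
  rintro v ⟨B, _, _, rfl⟩
  exact ENNReal.toReal_nonneg

lemma Ninv_le {d : ℕ} {ε : ℝ} (P : Finset (Fin d → ℝ)) (hP : (↑P : Set (Fin d → ℝ)) ⊆ cube d)
    (h : disp (↑P : Set (Fin d → ℝ)) ≤ ε) : Ninv ε d ≤ P.card := by
  apply Nat.sInf_le
  show minDisp P.card d ≤ ε
  unfold minDisp
  refine le_trans (csInf_le ⟨0, ?_⟩ ⟨P, hP, rfl, rfl⟩) h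
  rintro v ⟨Q, _, _, rfl⟩
  exact disp_nonneg _

open Classical in
lemma Ninv_bound (d K n : ℕ) (hd : 1 ≤ d) (ε : ℝ) (hε : 0 < ε) (hε1 : ε ≤ 1)
    (hK : ∀ k : ℕ, ε * 2 ^ k ≤ 1 → k < K)
    (hn : ((net d K ε).card : ℝ) * (1 - ε / 2) ^ n < 1) : Ninv ε d ≤ n := by
  obtain ⟨P, hP, hPn, hPi⟩ := greedy (netBox d) (ε / 2) (by linarith) n
    ((net d K ε).filter fun q => netBox d q ⊆ cube d ∧ ε / 2 ≤ volume.real (netBox d q))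
    (fun q hq => ⟨MeasurableSet.univ_pi fun _ => measurableSet_Ico, (Finset.mem_filter.1 hq).2⟩)
    (by
      refine lt_of_le_of_lt ?_ hn
      apply mul_le_mul_of_nonneg_right _ (pow_nonneg (by linarith) _)
      exact_mod_cast Finset.card_filter_le _ _)
  refine (Ninv_le P hP ?_).trans hPn
  apply Real.sSup_le _ hε.le
  rintro v ⟨B, hB, hBP, rfl⟩
  by_contra hv
  obtain ⟨q, hq, hqB, hqc⟩ := net_approx d K hd ε hε hK B hB (not_le.1 hv)
  obtain ⟨x, hxP, hxq⟩ := hPi q (Finset.mem_filter.2 ⟨hq, hqc⟩)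
  have : x ∈ B ∩ (↑P : Set (Fin d → ℝ)) := ⟨hqB hxq, hxP⟩
  rw [hBP] at this
  exact this

/-- There exists an absolute constant `C ≥ 1` such that for every integer `d ≥ 2` and every
`ε ∈ (0, 1/2]` with `ε ≤ exp(-d)`, one has `N(ε,d) ≤ (C ln d / ε) · ln(1/ε)`. -/
theorem minimal_dispersion_inverse_bound_small_eps :
    ∃ C : ℝ, 1 ≤ C ∧ ∀ d : ℕ, 2 ≤ d → ∀ ε : ℝ, 0 < ε → ε ≤ 1 / 2 →
      ε ≤ Real.exp (-(d : ℝ)) →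
      (Ninv ε d : ℝ) ≤ C * Real.log d / ε * Real.log (1 / ε) := by
  refine ⟨40, by norm_num, fun d hd ε hε hε2 hεd => ?_⟩
  have hd' : (2:ℝ) ≤ d := by exact_mod_cast hd
  obtain ⟨L, hL⟩ : ∃ L, L = Real.log (1 / ε) := ⟨_, rfl⟩
  obtain ⟨l, hl⟩ : ∃ l, l = Real.log d := ⟨_, rfl⟩
  have hLe : Real.exp L = 1 / ε := by rw [hL, Real.exp_log (by positivity)]
  have hLd : (d:ℝ) ≤ L := by
    rw [hL, one_div, Real.log_inv]
    have := Real.log_le_log hε hεd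
    rw [Real.log_exp] at this
    linarith
  have hlog2 := Real.log_two_gt_d9
  have hl2 : (1/2:ℝ) ≤ l := by
    rw [hl]
    have := Real.log_le_log (by norm_num) hd'
    linarith
  have hLl : L ≤ 2 * (L * l) := by nlinarith
  obtain ⟨K, hKdef⟩ : ∃ K, K = ⌊2 * L⌋₊ + 1 := ⟨_, rfl⟩
  have hK : ∀ k : ℕ, ε * 2 ^ k ≤ 1 → k < K := by
    intro k hk
    rw [hKdef, Nat.lt_succ_iff, Nat.le_floor_iff (by linarith)]
    have h1 : (2:ℝ) ^ k ≤ 1 / ε := by rw [le_div_iff₀ hε]; linarith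
    have h2 := Real.log_le_log (by positivity) h1
    rw [Real.log_pow, ← hL] at h2
    have : (0:ℝ) ≤ k := by positivity
    nlinarith
  have hK4 : (K:ℝ) ≤ 4 * L := by
    rw [hKdef]; push_cast
    have := Nat.floor_le (show 0 ≤ 2 * L by linarith)
    linarith
  have hK1 : (1:ℝ) ≤ K := by rw [hKdef]; push_cast; linarith [Nat.cast_nonneg (α := ℝ) ⌊2 * L⌋₊]
  have hcard : ((net d K ε).card : ℝ) ≤ Real.exp (19 * (L * l)) := by
    refine (net_card d K (by omega) ε hε).trans ?_
    rw [← hLe, ← mul_assoc, ← mul_pow]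
    have hbase : (K:ℝ) * (81 * (d:ℝ) ^ 2) ≤ Real.exp (6 + (l + (L / d - 1)) + 2 * l) := by
      have e1 : (324:ℝ) ≤ Real.exp 6 := by
        have := Real.exp_one_gt_d9
        have h6 : Real.exp 6 = Real.exp 1 ^ 6 := by rw [← Real.exp_nat_mul]; norm_num
        rw [h6]
        calc (324:ℝ) ≤ 2.7 ^ 6 := by norm_num
          _ ≤ _ := by gcongr; linarith
      have e2 : Real.exp l = d := by rw [hl, Real.exp_log (by linarith)]
      have e3 : L / d ≤ Real.exp (L / d - 1) := by linarith [Real.add_one_le_exp (L / d - 1)]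
      rw [Real.exp_add, Real.exp_add, Real.exp_add l, two_mul l, Real.exp_add l l, e2]
      calc (K:ℝ) * (81 * (d:ℝ) ^ 2) ≤ 4 * L * (81 * (d:ℝ) ^ 2) := by gcongr
        _ = 324 * (d * (L / d)) * (d * d) := by field_simp; ring
        _ ≤ _ := by
          have : 0 ≤ L / d := div_nonneg (by linarith) (by linarith)
          gcongr
    calc _ ≤ Real.exp (6 + (l + (L / d - 1)) + 2 * l) ^ d * Real.exp L := by gcongr
      _ = Real.exp (d * (6 + (l + (L / d - 1)) + 2 * l) + L) := by
        rw [← Real.exp_nat_mul, ← Real.exp_add]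
      _ ≤ _ := by
        apply Real.exp_le_exp.2
        have : (d:ℝ) * (6 + (l + (L / d - 1)) + 2 * l) = 5 * d + 3 * (d * l) + L := by
          field_simp; ring
        rw [this]
        nlinarith
  have hbd : Ninv ε d ≤ ⌊38 * (L * l) / ε⌋₊ + 1 := by
    apply Ninv_bound d K _ (by omega) ε hε (by linarith) hK
    have h1 := Nat.lt_floor_add_one (38 * (L * l) / ε)
    generalize hn : ⌊38 * (L * l) / ε⌋₊ + 1 = n
    have h2 : 38 * (L * l) / ε < n := by rw [← hn]; push_cast; exact h1
    rw [div_lt_iff₀ hε] at h2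
    have h3 : (1 - ε / 2) ^ n ≤ Real.exp (n * (-(ε / 2))) := by
      rw [Real.exp_nat_mul]
      exact pow_le_pow_left₀ (by linarith) (by linarith [Real.add_one_le_exp (-(ε / 2))]) _
    calc _ ≤ Real.exp (19 * (L * l)) * Real.exp (n * (-(ε / 2))) :=
          mul_le_mul hcard h3 (pow_nonneg (by linarith) _) (Real.exp_pos _).le
      _ = Real.exp (19 * (L * l) + n * (-(ε / 2))) := by rw [Real.exp_add]
      _ < 1 := by rw [Real.exp_lt_one_iff]; nlinarith
  have hfl := Nat.floor_le (show 0 ≤ 38 * (L * l) / ε from div_nonneg (by nlinarith) hε.le)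
  have hbd' : (Ninv ε d : ℝ) ≤ (⌊38 * (L * l) / ε⌋₊ : ℝ) + 1 := by exact_mod_cast hbd
  rw [← hL, ← hl]
  have h9 : (1:ℝ) ≤ 2 * (L * l) / ε := by rw [le_div_iff₀ hε]; linarith
  calc (Ninv ε d : ℝ) ≤ 38 * (L * l) / ε + 2 * (L * l) / ε := by linarith
    _ = 40 * l / ε * L := by ring
end
end

section
/- There exists an absolute constant C ≥ 1 such that for every integer d ≥ 2 and every ε ∈ (0, 1/2] with ε ≥ exp(-d), one has N(ε, d) ≤ (C · d / ε) · ln ln(2/ε). -/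
open MeasureTheory Set

noncomputable section

lemma cube_vol (d : ℕ) : volume (cube d) = 1 := by
  unfold cube
  rw [volume_pi_pi]; simp

lemma disp_greedy_step {ι : Type*} {d : ℕ} (F : Finset ι) (A : ι → Set (Fin d → ℝ))
    (hm : ∀ i ∈ F, MeasurableSet (A i)) (hs : ∀ i ∈ F, A i ⊆ cube d) (δ : ℝ)
    (hv : ∀ i ∈ F, δ ≤ (volume (A i)).toReal) :
    open Classical in
    ∃ x ∈ cube d, ((F.filter (fun i => x ∉ A i)).card : ℝ) ≤ (1 - δ) * F.card := by
  classical
  have hcm : MeasurableSet (cube d) := MeasurableSet.univ_pi fun _ => measurableSet_Icc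
  let f : (Fin d → ℝ) → ℝ := fun x => ∑ i ∈ F, (A i).indicator (fun _ => (1:ℝ)) x
  have hfin : ∀ i ∈ F, volume (A i) ≠ ⊤ := fun i hi =>
    ne_top_of_le_ne_top (by rw [cube_vol]; simp) (measure_mono (hs i hi))
  have hint : ∀ i ∈ F, IntegrableOn ((A i).indicator (fun _ => (1:ℝ))) (cube d) volume := by
    intro i hi
    apply Integrable.integrableOn
    exact (integrable_indicator_iff (hm i hi)).2 (by
      rw [integrableOn_const_iff]; right; exact (hfin i hi).lt_top)
  have hI : ∫ x in cube d, f x = ∑ i ∈ F, (volume (A i)).toReal := by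
    show ∫ x in cube d, (∑ i ∈ F, (A i).indicator (fun _ => (1:ℝ)) x) = _
    rw [integral_finsetSum _ hint]
    refine Finset.sum_congr rfl fun i hi => ?_
    rw [integral_indicator (hm i hi), Measure.restrict_restrict (hm i hi),
      inter_eq_left.2 (hs i hi)]
    simp [Measure.real]
  have hfi : IntegrableOn f (cube d) volume := integrable_finsetSum _ hint
  obtain ⟨x, hx, hle⟩ := exists_setAverage_le (μ := volume) (s := cube d) (f := f)
    (by rw [cube_vol]; simp) (by rw [cube_vol]; simp) hfi
  have hav : (⨍ a in cube d, f a) = ∑ i ∈ F, (volume (A i)).toReal := by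
    rw [setAverage_eq, hI]; simp [Measure.real, cube_vol]
  rw [hav] at hle
  refine ⟨x, hx, ?_⟩
  have h1 : δ * F.card ≤ f x := by
    refine le_trans ?_ hle
    have := Finset.card_nsmul_le_sum F _ δ hv
    rw [nsmul_eq_mul] at this; linarith
  have h2 : f x = ((F.filter (fun i => x ∈ A i)).card : ℝ) := by
    simp [f, Set.indicator_apply]
  have h3 := Finset.card_filter_add_card_filter_not (s := F) (fun i => x ∈ A i)
  have h3' : ((F.filter (fun i => x ∈ A i)).card : ℝ) + ((F.filter (fun i => x ∉ A i)).card : ℝ) = F.card := by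
    exact_mod_cast h3
  linarith

lemma disp_greedy {ι : Type*} {d : ℕ} (F : Finset ι) (A : ι → Set (Fin d → ℝ))
    (hm : ∀ i ∈ F, MeasurableSet (A i)) (hs : ∀ i ∈ F, A i ⊆ cube d) (δ : ℝ) (hδ : δ ≤ 1)
    (hv : ∀ i ∈ F, δ ≤ (volume (A i)).toReal) (n : ℕ) :
    open Classical in
    ∃ P : Finset (Fin d → ℝ), ↑P ⊆ cube d ∧ P.card ≤ n ∧
      ((F.filter (fun i => ∀ p ∈ P, p ∉ A i)).card : ℝ) ≤ (1 - δ) ^ n * F.card := by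
  classical
  induction n with
  | zero => exact ⟨∅, by simp, by simp, by simp⟩
  | succ n ih =>
    obtain ⟨P, hP, hc, hb⟩ := ih
    obtain ⟨x, hx, hxb⟩ := disp_greedy_step (F.filter (fun i => ∀ p ∈ P, p ∉ A i)) A
      (fun i hi => hm i (Finset.mem_filter.1 hi).1) (fun i hi => hs i (Finset.mem_filter.1 hi).1) δ
      (fun i hi => hv i (Finset.mem_filter.1 hi).1)
    refine ⟨insert x P, ?_, (Finset.card_insert_le _ _).trans (by omega), ?_⟩
    · intro y hy
      simp only [Finset.coe_insert, Set.mem_insert_iff] at hy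
      rcases hy with rfl | hy
      · exact hx
      · exact hP hy
    · have : F.filter (fun i => ∀ p ∈ insert x P, p ∉ A i) =
        (F.filter (fun i => ∀ p ∈ P, p ∉ A i)).filter (fun i => x ∉ A i) := by
        ext i; simp only [Finset.mem_filter, Finset.mem_insert, forall_eq_or_imp]; tauto
      rw [this]
      refine hxb.trans ?_
      rw [pow_succ', mul_assoc]
      exact mul_le_mul_of_nonneg_left hb (by linarith)

lemma vol_box {d : ℕ} (a b : Fin d → ℝ) (h : ∀ i, a i ≤ b i) :
    (volume (Set.univ.pi fun i => Set.Ico (a i) (b i))).toReal = ∏ i, (b i - a i) := by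
  rw [Real.volume_pi_Ico_toReal]
  exact h

lemma ninv_le {d : ℕ} (ε : ℝ) (hε : 0 < ε) (P : Finset (Fin d → ℝ)) (hP : ↑P ⊆ cube d)
    (h : ∀ a b : Fin d → ℝ, (∀ i, 0 ≤ a i ∧ a i ≤ b i ∧ b i ≤ 1) → ε < ∏ i, (b i - a i) →
      ∃ p ∈ P, p ∈ Set.univ.pi fun i => Set.Ico (a i) (b i)) : Ninv ε d ≤ P.card := by
  apply Nat.sInf_le
  show minDisp P.card d ≤ ε
  have hd : disp (↑P : Set (Fin d → ℝ)) ≤ ε := by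
    apply Real.sSup_le _ hε.le
    rintro v ⟨B, ⟨a, b, hab, rfl⟩, hB, rfl⟩
    rw [vol_box a b (fun i => (hab i).2.1)]
    by_contra! hlt
    obtain ⟨p, hp, hpB⟩ := h a b hab hlt
    have : p ∈ (∅ : Set (Fin d → ℝ)) := hB ▸ ⟨hpB, hp⟩
    exact this
  refine le_trans (csInf_le ⟨0, ?_⟩ ⟨P, hP, rfl, rfl⟩) hd
  rintro v ⟨P', -, -, rfl⟩
  apply Real.sSup_nonneg
  rintro v ⟨B, -, -, rfl⟩
  exact ENNReal.toReal_nonneg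

lemma count_pi {α : Type*} (d : ℕ) (T : Finset α) (w : α → ℝ) (t W : ℝ) (ht : 0 ≤ t)
    (G : Finset (Fin d → α)) (hG : ∀ g ∈ G, (∀ i, g i ∈ T) ∧ ∑ i, w (g i) ≤ W) :
    (G.card : ℝ) ≤ Real.exp (t * W) * (∑ x ∈ T, Real.exp (-(t * w x))) ^ d := by
  classical
  have h1 : (∑ x ∈ T, Real.exp (-(t * w x))) ^ d =
      ∑ g ∈ Fintype.piFinset (fun _ : Fin d => T), ∏ i, Real.exp (-(t * w (g i))) := by
    rw [← Finset.prod_univ_sum (fun _ : Fin d => T) (fun _ x => Real.exp (-(t * w x)))]; simp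
  rw [h1, Finset.mul_sum]
  have hsub : G ⊆ Fintype.piFinset (fun _ : Fin d => T) := fun g hg =>
    Fintype.mem_piFinset.2 (hG g hg).1
  refine le_trans ?_ (Finset.sum_le_sum_of_subset_of_nonneg hsub (fun g _ _ => by positivity))
  rw [Finset.card_eq_sum_ones]; push_cast
  refine Finset.sum_le_sum fun g hg => ?_
  rw [← Real.exp_sum, ← Real.exp_add]
  apply Real.one_le_exp
  rw [Finset.sum_neg_distrib, ← Finset.mul_sum]
  nlinarith [mul_le_mul_of_nonneg_left (hG g hg).2 ht]


lemma exp_neg_two_le (x : ℝ) (h0 : 0 ≤ x) (h1 : x ≤ 1 / 2) : Real.exp (-(2 * x)) ≤ 1 - x := by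
  rw [Real.exp_neg]
  have h2 : 1 + 2 * x ≤ Real.exp (2 * x) := by linarith [Real.add_one_le_exp (2 * x)]
  refine (inv_anti₀ (by linarith) h2).trans ?_
  rw [inv_le_iff_one_le_mul₀ (by linarith)]
  nlinarith

def netS (d : ℕ) (L : ℝ) (m : ℕ) : ℝ := if m = 0 then 1 / (8 * d) else (1 / 2) ^ m / (8 * L)

def netT (d : ℕ) (L : ℝ) : Finset (Σ _ : ℕ, ℕ × ℕ) :=
  (Finset.range (⌊L / Real.log 2⌋₊ + 1)).sigma fun m =>
    Finset.range (⌈1 / netS d L m⌉₊ + 1) ×ˢ Finset.range (⌈1 / netS d L m⌉₊ + 1)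

def netW (d : ℕ) (x : Σ _ : ℕ, ℕ × ℕ) : ℝ :=
  if x.1 = 0 then ((x.2.1 : ℝ) + x.2.2) / (8 * d) else x.1 * Real.log 2

def netLo (d : ℕ) (L : ℝ) (x : Σ _ : ℕ, ℕ × ℕ) : ℝ := x.2.1 * netS d L x.1
def netHi (d : ℕ) (L : ℝ) (x : Σ _ : ℕ, ℕ × ℕ) : ℝ := 1 - x.2.2 * netS d L x.1

lemma netS_pos (d : ℕ) (L : ℝ) (hd : 1 ≤ d) (hL : 1 ≤ L) (m : ℕ) : 0 < netS d L m := by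
  unfold netS
  have : (0:ℝ) < d := by exact_mod_cast hd
  split_ifs <;> positivity

lemma net_approx_s1 (d : ℕ) (L a b : ℝ) (hd : 1 ≤ d) (hL : 1 ≤ L) (ha : 0 ≤ a) (hb : b ≤ 1)
    (hab : a < b) (hu : -Real.log (b - a) ≤ L) :
    ∃ x ∈ netT d L, a ≤ netLo d L x ∧ netHi d L x ≤ b ∧
      (b - a) * Real.exp (-(1 / d + 2 * (-Real.log (b - a)) / L)) ≤ netHi d L x - netLo d L x ∧
      netW d x ≤ -Real.log (b - a) + 1 / (4 * d) := by
  set l := b - a with hl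
  set u := -Real.log l with hudef
  have hl0 : 0 < l := by linarith
  have hl1 : l ≤ 1 := by linarith
  have hu0 : 0 ≤ u := by
    have := Real.log_nonpos hl0.le hl1
    linarith
  have hlog2 : 0 < Real.log 2 := Real.log_pos (by norm_num)
  have hlog2' : (1:ℝ) / 2 ≤ Real.log 2 := by linarith [Real.log_two_gt_d9]
  have hd0 : (0:ℝ) < d := by exact_mod_cast hd
  have hd1 : (1:ℝ) ≤ d := by exact_mod_cast hd
  have hlu : l = Real.exp (-u) := by rw [hudef, neg_neg, Real.exp_log hl0]
  set m := ⌊u / Real.log 2⌋₊ with hm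
  have hm1 : m * Real.log 2 ≤ u := by
    have := Nat.floor_le (div_nonneg hu0 hlog2.le)
    rwa [le_div_iff₀ hlog2] at this
  have hm2 : u < (m + 1) * Real.log 2 := by
    have := Nat.lt_floor_add_one (u / Real.log 2)
    rwa [div_lt_iff₀ hlog2] at this
  have hml : (1 / 2 : ℝ) ^ (m + 1) ≤ l := by
    rw [hlu]
    have : (1 / 2 : ℝ) ^ (m + 1) = Real.exp (-((m + 1) * Real.log 2)) := by
      rw [show -(((m:ℝ) + 1) * Real.log 2) = ((m + 1 : ℕ) : ℝ) * (-Real.log 2) by push_cast; ring,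
        Real.exp_nat_mul, Real.exp_neg, Real.exp_log (by norm_num)]
      norm_num
    rw [this]
    exact Real.exp_le_exp.2 (by linarith)
  have hs := netS_pos d L hd hL m
  set s := netS d L m with hsdef
  have hk1 : a ≤ ⌈a / s⌉₊ * s := by
    have := Nat.le_ceil (a / s)
    rwa [div_le_iff₀ hs] at this
  have hk2 : ⌈a / s⌉₊ * s ≤ a + s := by
    have := (Nat.ceil_lt_add_one (div_nonneg ha hs.le)).le
    have h2 := mul_le_mul_of_nonneg_right this hs.le
    rwa [add_mul, div_mul_cancel₀ _ hs.ne', one_mul] at h2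
  have hj1 : 1 - b ≤ ⌈(1 - b) / s⌉₊ * s := by
    have := Nat.le_ceil ((1 - b) / s)
    rwa [div_le_iff₀ hs] at this
  have hj2 : ⌈(1 - b) / s⌉₊ * s ≤ 1 - b + s := by
    have := (Nat.ceil_lt_add_one (div_nonneg (by linarith : 0 ≤ 1 - b) hs.le)).le
    have h2 := mul_le_mul_of_nonneg_right this hs.le
    rwa [add_mul, div_mul_cancel₀ _ hs.ne', one_mul] at h2
  have h1l : 1 - l ≤ u := by
    have := Real.log_le_sub_one_of_pos hl0
    linarith
  refine ⟨⟨m, ⌈a / s⌉₊, ⌈(1 - b) / s⌉₊⟩, ?_, hk1, ?_, ?_, ?_⟩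
  · simp only [netT, Finset.mem_sigma, Finset.mem_range, Finset.mem_product]
    refine ⟨?_, ?_, ?_⟩
    · exact Nat.lt_succ_of_le (Nat.floor_mono (div_le_div_of_nonneg_right hu hlog2.le))
    · exact Nat.lt_succ_of_le (Nat.ceil_mono (div_le_div_of_nonneg_right (by linarith) hs.le))
    · exact Nat.lt_succ_of_le (Nat.ceil_mono (div_le_div_of_nonneg_right (by linarith) hs.le))
  · simp only [netHi]
    linarith
  · simp only [netHi, netLo, ← hsdef]
    have key : l * Real.exp (-(1 / d + 2 * u / L)) ≤ l - 2 * s := by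
      -- choose x with 2 s ≤ l x
      obtain ⟨x, hx0, hx1, hx2, hx3⟩ : ∃ x : ℝ, 0 ≤ x ∧ x ≤ 1 / 2 ∧ 2 * s ≤ l * x ∧
          2 * x ≤ 1 / d + 2 * u / L := by
        by_cases h0 : m = 0
        · refine ⟨1 / (2 * d), by positivity, ?_, ?_, ?_⟩
          · rw [div_le_div_iff₀ (by positivity) (by norm_num)]; linarith
          · have : s = 1 / (8 * d) := by rw [hsdef, netS, if_pos h0]
            rw [h0] at hml
            rw [this]
            have : 2 * (1 / (8 * (d:ℝ))) = (1/2) ^ (0+1) * (1 / (2 * d)) := by field_simp; norm_num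
            rw [this]
            gcongr
          · have : 0 ≤ 2 * u / L := by positivity
            have : 2 * (1 / (2 * (d:ℝ))) = 1 / d := by field_simp
            linarith
        · refine ⟨1 / (2 * L), by positivity, ?_, ?_, ?_⟩
          · rw [div_le_div_iff₀ (by positivity) (by norm_num)]; linarith
          · have : s = (1 / 2) ^ m / (8 * L) := by rw [hsdef, netS, if_neg h0]
            rw [this]
            have : 2 * ((1 / 2) ^ m / (8 * L)) = (1/2) ^ (m+1) * (1 / (2 * L)) := by
              rw [pow_succ]; field_simp; norm_num
            rw [this]
            gcongr
          · have h1 : (1:ℝ) ≤ m := by exact_mod_cast Nat.one_le_iff_ne_zero.2 h0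
            have h2 : 1 ≤ 2 * u := by nlinarith
            have h3 : 1 / L ≤ 2 * u / L := by gcongr
            have : 2 * (1 / (2 * L)) = 1 / L := by field_simp
            have : 0 ≤ 1 / (d:ℝ) := by positivity
            linarith
      have h1 : Real.exp (-(1 / d + 2 * u / L)) ≤ 1 - x :=
        (Real.exp_le_exp.2 (by linarith)).trans (exp_neg_two_le x hx0 hx1)
      have := mul_le_mul_of_nonneg_left h1 hl0.le
      linarith
    linarith
  · simp only [netW]
    split_ifs with h0
    · have hs' : s = 1 / (8 * d) := by rw [hsdef, netS, if_pos h0]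
      have : ((⌈a / s⌉₊ : ℝ) + ⌈(1 - b) / s⌉₊) / (8 * d) = ⌈a / s⌉₊ * s + ⌈(1 - b) / s⌉₊ * s := by
        rw [← add_mul]; conv_rhs => rw [hs']
        rw [hs']; ring
      rw [this]
      have : 1 / (4 * (d:ℝ)) = 2 * s := by rw [hs']; field_simp; norm_num
      linarith
    · have : 0 ≤ 1 / (4 * (d:ℝ)) := by positivity
      linarith

lemma geom_exp (x : ℝ) (hx : 0 < x) (n : ℕ) :
    ∑ k ∈ Finset.range n, Real.exp (-(x * k)) ≤ 1 + 1 / x := by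
  have h1 : Real.exp (-x) ≤ 1 / (1 + x) := by
    rw [Real.exp_neg, ← one_div]
    exact one_div_le_one_div_of_le (by linarith) (by linarith [Real.add_one_le_exp x])
  have hr : Real.exp (-x) < 1 := Real.exp_zero ▸ Real.exp_lt_exp.2 (by linarith)
  have h2 : ∀ k : ℕ, Real.exp (-(x * k)) = Real.exp (-x) ^ k := by
    intro k; rw [← Real.exp_nat_mul]; ring_nf
  simp_rw [h2]
  refine (Summable.sum_le_tsum _ (fun k _ => by positivity)
    (summable_geometric_of_lt_one (by positivity) hr)).trans ?_
  rw [tsum_geometric_of_lt_one (by positivity) hr]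
  have h3 : x / (1 + x) ≤ 1 - Real.exp (-x) := by
    have : x / (1 + x) = 1 - 1 / (1 + x) := by field_simp; ring
    linarith
  refine (inv_anti₀ (by positivity) h3).trans (le_of_eq ?_)
  field_simp
  ring

lemma net_sum (d : ℕ) (L t : ℝ) (hd : 1 ≤ d) (hL : 1 ≤ L) (ht : t = 8 * d / L) (ht3 : 3 ≤ t) :
    ∑ x ∈ netT d L, Real.exp (-(t * netW d x)) ≤ 104 * L ^ 2 := by
  have hd0 : (0:ℝ) < d := by exact_mod_cast hd
  unfold netT
  rw [Finset.sum_sigma, Finset.sum_range_succ']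
  have h0 : ∑ x ∈ Finset.range (⌈1 / netS d L 0⌉₊ + 1) ×ˢ Finset.range (⌈1 / netS d L 0⌉₊ + 1),
      Real.exp (-(t * netW d ⟨0, x⟩)) ≤ 4 * L ^ 2 := by
    set n := ⌈1 / netS d L 0⌉₊ + 1
    have : ∀ x : ℕ × ℕ, Real.exp (-(t * netW d ⟨0, x⟩)) =
        Real.exp (-(1 / L * x.1)) * Real.exp (-(1 / L * x.2)) := by
      intro x
      rw [← Real.exp_add]
      congr 1
      simp only [netW, if_true, ht]
      field_simp
      ring
    simp_rw [this]
    rw [Finset.sum_product]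
    dsimp only
    rw [← Finset.sum_mul_sum]
    have hg := geom_exp (1 / L) (by positivity) n
    rw [one_div_one_div] at hg
    have hp : 0 ≤ ∑ k ∈ Finset.range n, Real.exp (-(1 / L * k)) :=
      Finset.sum_nonneg fun _ _ => (Real.exp_pos _).le
    nlinarith
  have hm : ∀ m : ℕ, ∑ x ∈ Finset.range (⌈1 / netS d L (m+1)⌉₊ + 1) ×ˢ
      Finset.range (⌈1 / netS d L (m+1)⌉₊ + 1),
      Real.exp (-(t * netW d ⟨m+1, x⟩)) ≤ 50 * L ^ 2 * (1 / 2) ^ m := by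
    intro m
    have hW : ∀ x : ℕ × ℕ, Real.exp (-(t * netW d ⟨m+1, x⟩)) ≤ (1 / 8) ^ (m + 1) := by
      intro x
      simp only [netW, if_neg (Nat.succ_ne_zero m)]
      have : (1 / 8 : ℝ) ^ (m + 1) = Real.exp (-(3 * ((m + 1 : ℕ) * Real.log 2))) := by
        rw [show -(3 * (((m + 1 : ℕ):ℝ) * Real.log 2)) = ((m + 1 : ℕ) : ℝ) * (-(3 * Real.log 2)) by ring,
          Real.exp_nat_mul, Real.exp_neg, show (3:ℝ) = ((3:ℕ):ℝ) by norm_num, Real.exp_nat_mul,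
          Real.exp_log (by norm_num)]
        norm_num
      rw [this]
      apply Real.exp_le_exp.2
      have : 0 ≤ ((m + 1 : ℕ):ℝ) * Real.log 2 := by positivity
      nlinarith
    refine (Finset.sum_le_card_nsmul _ _ _ (fun x _ => hW x)).trans ?_
    rw [nsmul_eq_mul, Finset.card_product, Finset.card_range]
    have hS : 1 / netS d L (m + 1) = 8 * L * 2 ^ (m + 1) := by
      rw [netS, if_neg (Nat.succ_ne_zero m), one_div_pow]; field_simp
    have hp : (1:ℝ) ≤ 2 ^ (m + 1) := one_le_pow₀ (by norm_num)
    have hc : ((⌈1 / netS d L (m+1)⌉₊ + 1 : ℕ) : ℝ) ≤ 10 * L * 2 ^ (m + 1) := by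
      push_cast
      rw [hS]
      have := (Nat.ceil_lt_add_one (show 0 ≤ 8 * L * 2 ^ (m + 1) by positivity)).le
      have : 1 ≤ L * 2 ^ (m + 1) := one_le_mul_of_one_le_of_one_le hL hp
      linarith
    rw [Nat.cast_mul]
    calc _ ≤ (10 * L * 2 ^ (m + 1)) * (10 * L * 2 ^ (m + 1)) * (1 / 8) ^ (m + 1) := by gcongr
      _ = 100 * L ^ 2 * (2 * 2 * (1 / 8)) ^ (m + 1) := by rw [mul_pow, mul_pow]; ring
      _ = 50 * L ^ 2 * (1 / 2) ^ m := by rw [pow_succ]; norm_num; ring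
  have hsum : ∀ n : ℕ, ∑ m ∈ Finset.range n, 50 * L ^ 2 * (1 / 2 : ℝ) ^ m ≤ 100 * L ^ 2 := by
    intro n
    rw [← Finset.mul_sum]
    have := sum_geometric_two_le n
    nlinarith [sq_nonneg L]
  have := (Finset.sum_le_sum fun m _ => hm m).trans (hsum ⌊L / Real.log 2⌋₊)
  linarith

/-- There exists an absolute constant `C ≥ 1` such that for every integer `d ≥ 2` and every
`ε ∈ (0, 1/2]` with `ε ≥ exp(-d)`, one has `N(ε,d) ≤ (C d / ε) · ln ln(2/ε)`. -/
theorem minimal_dispersion_inverse_bound_large_eps :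
    ∃ C : ℝ, 1 ≤ C ∧ ∀ d : ℕ, 2 ≤ d → ∀ ε : ℝ, 0 < ε → ε ≤ 1 / 2 →
      Real.exp (-(d : ℝ)) ≤ ε →
      (Ninv ε d : ℝ) ≤ C * d / ε * Real.log (Real.log (2 / ε)) := by
  classical
  refine ⟨1400, by norm_num, ?_⟩
  intro d hd ε hε hε2 hεd
  set L := Real.log (2 / ε) with hLdef
  have hd0 : (0:ℝ) < d := by exact_mod_cast (by omega : 0 < d)
  have hd2 : (2:ℝ) ≤ d := by exact_mod_cast hd
  have hl2 := Real.log_two_gt_d9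
  have hl2' := Real.log_two_lt_d9
  have hLe : L = Real.log 2 - Real.log ε := by
    rw [hLdef, Real.log_div (by norm_num) hε.ne']
  have hL4 : (4:ℝ) / 3 ≤ L := by
    have : Real.log ε ≤ Real.log (1 / 2) := Real.log_le_log hε hε2
    rw [one_div, Real.log_inv] at this
    linarith
  have hL1 : 1 ≤ L := by linarith
  have hL0 : 0 < L := by linarith
  have hLd : L ≤ 2 * d := by
    have : -(d:ℝ) ≤ Real.log ε := (Real.le_log_iff_exp_le hε).2 hεd
    linarith
  have hLL : 1 / 4 ≤ Real.log L := by
    have h1 := Real.one_sub_inv_le_log_of_pos hL0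
    have h2 : L⁻¹ ≤ (4 / 3 : ℝ)⁻¹ := inv_anti₀ (by norm_num) hL4
    norm_num at h2
    linarith
  set t : ℝ := 8 * d / L with ht
  have ht3 : 3 ≤ t := by
    rw [ht, le_div_iff₀ hL0]; linarith
  set W : ℝ := L + 1 / 4 with hW
  set δ : ℝ := Real.exp (-3) * ε with hδ
  have hδ0 : 0 < δ := by positivity
  have hδ1 : δ ≤ 1 := by
    have : Real.exp (-3) ≤ 1 := Real.exp_le_one_iff.2 (by norm_num)
    calc δ ≤ 1 * ε := by rw [hδ]; gcongr
      _ ≤ 1 := by linarith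
  let G : Finset (Fin d → Σ _ : ℕ, ℕ × ℕ) :=
    (Fintype.piFinset (fun _ : Fin d => netT d L)).filter fun g =>
      ∑ i, netW d (g i) ≤ W ∧ (∀ i, netLo d L (g i) ≤ netHi d L (g i)) ∧
        δ ≤ ∏ i, (netHi d L (g i) - netLo d L (g i))
  let A : (Fin d → Σ _ : ℕ, ℕ × ℕ) → Set (Fin d → ℝ) := fun g =>
    Set.univ.pi fun i => Set.Ico (netLo d L (g i)) (netHi d L (g i))
  set D : ℝ := d * (15 + 2 * Real.log L) with hD
  have hD0 : 0 ≤ D := by positivity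
  have hGc : (G.card : ℝ) ≤ Real.exp D := by
    have h1 := count_pi d (netT d L) (netW d) t W (by linarith) G (by
      intro g hg
      have := Finset.mem_filter.1 hg
      exact ⟨Fintype.mem_piFinset.1 this.1, this.2.1⟩)
    have h2 := net_sum d L t (by omega) hL1 ht ht3
    have h3 : (104 : ℝ) ≤ Real.exp 5 := by
      have := Real.exp_one_gt_d9
      have h5 : Real.exp 5 = Real.exp 1 ^ 5 := by rw [← Real.exp_nat_mul]; norm_num
      rw [h5]
      calc (104:ℝ) ≤ 2.7 ^ 5 := by norm_num
        _ ≤ _ := by gcongr; linarith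
    have h4 : 104 * L ^ 2 ≤ Real.exp (5 + 2 * Real.log L) := by
      have : Real.exp (2 * Real.log L) = L ^ 2 := by
        rw [show 2 * Real.log L = ((2:ℕ):ℝ) * Real.log L by norm_num, Real.exp_nat_mul, Real.exp_log hL0]
      rw [Real.exp_add, this]
      gcongr
    have h5 : t * W ≤ 10 * d := by
      rw [ht, hW, div_mul_eq_mul_div, div_le_iff₀ hL0]
      nlinarith
    have hn : 0 ≤ ∑ x ∈ netT d L, Real.exp (-(t * netW d x)) :=
      Finset.sum_nonneg fun _ _ => (Real.exp_pos _).le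
    calc (G.card : ℝ) ≤ _ := h1
      _ ≤ Real.exp (10 * d) * Real.exp (5 + 2 * Real.log L) ^ d := by
          gcongr
          exact h2.trans h4
      _ = Real.exp D := by
          rw [← Real.exp_nat_mul, ← Real.exp_add, hD]; congr 1; ring
  set n := ⌊D / δ⌋₊ + 1 with hn
  have hn1 : D < δ * n := by
    have := Nat.lt_floor_add_one (D / δ)
    rw [div_lt_iff₀ hδ0] at this
    rw [hn]; push_cast; linarith
  obtain ⟨P, hPc, hPn, hPG⟩ := disp_greedy G A
    (fun g _ => MeasurableSet.univ_pi fun _ => measurableSet_Ico)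
    (by
      intro g _ x hx i hi
      have := hx i hi
      have hs := netS_pos d L (by omega) hL1 (g i).1
      have h1 : 0 ≤ netLo d L (g i) := by unfold netLo; positivity
      have h2 : netHi d L (g i) ≤ 1 := by
        have : 0 ≤ ((g i).2.2 : ℝ) * netS d L (g i).1 := by positivity
        unfold netHi; linarith
      exact ⟨h1.trans this.1, this.2.le.trans h2⟩) δ hδ1
    (by
      intro g hg
      have := (Finset.mem_filter.1 hg).2
      rw [vol_box _ _ this.2.1]
      exact this.2.2) n
  have hempty : ((G.filter (fun i => ∀ p ∈ P, p ∉ A i)).card : ℝ) < 1 := by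
    refine hPG.trans_lt ?_
    have h1 : (1 - δ) ^ n ≤ Real.exp (-(δ * n)) := by
      have : 1 - δ ≤ Real.exp (-δ) := by linarith [Real.add_one_le_exp (-δ)]
      calc (1 - δ) ^ n ≤ Real.exp (-δ) ^ n := pow_le_pow_left₀ (by linarith) this n
        _ = _ := by rw [← Real.exp_nat_mul]; congr 1; ring
    calc (1 - δ) ^ n * G.card ≤ Real.exp (-(δ * n)) * Real.exp D := by gcongr
      _ = Real.exp (-(δ * n) + D) := by rw [Real.exp_add]
      _ < 1 := by rw [Real.exp_lt_one_iff]; linarith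
  have hempty' : G.filter (fun i => ∀ p ∈ P, p ∉ A i) = ∅ := by
    rw [← Finset.card_eq_zero]
    have : (G.filter (fun i => ∀ p ∈ P, p ∉ A i)).card < 1 := by exact_mod_cast hempty
    omega
  have hN : Ninv ε d ≤ P.card := by
    apply ninv_le ε hε P hPc
    intro a b hab hvol
    have hne : ∀ i, a i < b i := by
      intro i
      by_contra hcon
      have h0 : b i - a i = 0 := by linarith [(hab i).2.1]
      have : ∏ i, (b i - a i) = 0 := Finset.prod_eq_zero (Finset.mem_univ i) h0
      linarith
    have hpos : ∀ i, 0 < b i - a i := fun i => by linarith [hne i]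
    have hu0 : ∀ i, 0 ≤ -Real.log (b i - a i) := fun i => by
      have := Real.log_nonpos (hpos i).le (by linarith [(hab i).1, (hab i).2.2])
      linarith
    have husum : ∑ i, -Real.log (b i - a i) ≤ L := by
      rw [Finset.sum_neg_distrib, ← Real.log_prod (fun i _ => (hpos i).ne')]
      have := Real.log_le_log hε hvol.le
      linarith
    have hui : ∀ i, -Real.log (b i - a i) ≤ L := fun i =>
      (Finset.single_le_sum (f := fun i => -Real.log (b i - a i)) (fun j _ => hu0 j)
        (Finset.mem_univ i)).trans husum
    choose g hgT hg1 hg2 hg3 hg4 using fun i => net_approx_s1 d L (a i) (b i) (by omega) hL1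
      (hab i).1 (hab i).2.2 (hne i) (hui i)
    have hgG : g ∈ G := by
      refine Finset.mem_filter.2 ⟨Fintype.mem_piFinset.2 hgT, ?_, ?_, ?_⟩
      · refine (Finset.sum_le_sum fun i _ => hg4 i).trans ?_
        rw [Finset.sum_add_distrib]
        have : ∑ _i : Fin d, 1 / (4 * (d:ℝ)) = 1 / 4 := by
          simp; field_simp
        linarith
      · intro i
        have := hg3 i
        have h2 : 0 < (b i - a i) * Real.exp (-(1 / d + 2 * (-Real.log (b i - a i)) / L)) :=
          mul_pos (hpos i) (Real.exp_pos _)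
        linarith
      · refine le_trans ?_ (Finset.prod_le_prod
          (fun i _ => (mul_pos (hpos i) (Real.exp_pos _)).le) (fun i _ => hg3 i))
        rw [Finset.prod_mul_distrib, ← Real.exp_sum, hδ, mul_comm]
        have : (-3:ℝ) ≤ ∑ i, -(1 / (d:ℝ) + 2 * (-Real.log (b i - a i)) / L) := by
          rw [Finset.sum_neg_distrib, Finset.sum_add_distrib]
          have h1 : ∑ _i : Fin d, 1 / (d:ℝ) = 1 := by simp; field_simp
          have h3 : ∑ i, 2 * (-Real.log (b i - a i)) / L = 2 * (∑ i, -Real.log (b i - a i)) / L := by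
            rw [← Finset.sum_div, ← Finset.mul_sum]
          have h2 : 2 * (∑ i, -Real.log (b i - a i)) / L ≤ 2 := by
            rw [div_le_iff₀ hL0]; linarith
          linarith
        exact mul_le_mul hvol.le (Real.exp_le_exp.2 this) (Real.exp_pos _).le (hε.le.trans hvol.le)
    by_contra! hcon
    have : g ∈ G.filter (fun i => ∀ p ∈ P, p ∉ A i) := by
      refine Finset.mem_filter.2 ⟨hgG, fun p hp hpA => hcon p hp ?_⟩
      intro i hi
      have := hpA i hi
      exact ⟨(hg1 i).trans this.1, this.2.trans_le (hg2 i)⟩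
    rw [hempty'] at this
    simp at this
  have hfin : (Ninv ε d : ℝ) ≤ n := by exact_mod_cast hN.trans hPn
  refine hfin.trans ?_
  have h1 : (n : ℝ) ≤ D / δ + 1 := by
    rw [hn]; push_cast
    linarith [Nat.floor_le (div_nonneg hD0 hδ0.le)]
  have he3 : Real.exp 3 ≤ 21 := by
    have := Real.exp_one_lt_d9
    have h5 : Real.exp 3 = Real.exp 1 ^ 3 := by rw [← Real.exp_nat_mul]; norm_num
    rw [h5]
    calc Real.exp 1 ^ 3 ≤ 2.72 ^ 3 := by gcongr; linarith
      _ ≤ 21 := by norm_num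
  have h2 : D / δ = Real.exp 3 * D / ε := by
    rw [hδ, Real.exp_neg]; field_simp
  have h3 : D ≤ 62 * (d * Real.log L) := by
    rw [hD]; nlinarith
  have h4 : Real.exp 3 * D / ε ≤ 21 * (62 * (d * Real.log L)) / ε := by gcongr
  have h5 : 1 ≤ 4 * (d * Real.log L) / ε := by
    rw [le_div_iff₀ hε]; nlinarith
  calc (n:ℝ) ≤ 21 * (62 * (d * Real.log L)) / ε + 4 * (d * Real.log L) / ε := by linarith
    _ = 1306 * (d * Real.log L / ε) := by ring
    _ ≤ 1400 * (d * Real.log L / ε) := by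
        have : 0 ≤ d * Real.log L / ε := by positivity
        linarith
    _ = 1400 * d / ε * Real.log L := by ring
end
end

section
/- There exists an absolute constant C ≥ 1 such that for every integer d ≥ 2 and every ε ∈ (0, 1/2] with ε ≥ (ln d)/d, one has N(ε, d) ≤ (C · ln d / ε²) · ln(1/ε). -/
open MeasureTheory Set

noncomputable section

lemma aux_weier {ι : Type*} (s : Finset ι) (x : ι → ℝ) (h0 : ∀ i ∈ s, 0 ≤ x i)
    (h1 : ∀ i ∈ s, x i ≤ 1) :
    1 - ∑ i ∈ s, x i ≤ ∏ i ∈ s, (1 - x i) ∧ ∏ i ∈ s, (1 - x i) ≤ 1 := by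
  classical
  induction s using Finset.induction_on with
  | empty => simp
  | insert a s ha ih =>
    rw [Finset.sum_insert ha, Finset.prod_insert ha]
    obtain ⟨h2, h3⟩ := ih (fun i hi => h0 i (Finset.mem_insert_of_mem hi))
      (fun i hi => h1 i (Finset.mem_insert_of_mem hi))
    have ha0 := h0 a (Finset.mem_insert_self _ _)
    have ha1 := h1 a (Finset.mem_insert_self _ _)
    have h4 : 0 ≤ ∏ i ∈ s, (1 - x i) := Finset.prod_nonneg fun i hi => by
      linarith [h1 i (Finset.mem_insert_of_mem hi)]
    constructor <;> nlinarith

lemma aux_weier2 {ι : Type*} (s : Finset ι) (x : ι → ℝ) (h0 : ∀ i ∈ s, 0 ≤ x i) :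
    1 + ∑ i ∈ s, x i ≤ ∏ i ∈ s, (1 + x i) := by
  classical
  induction s using Finset.induction_on with
  | empty => simp
  | insert a s ha ih =>
    rw [Finset.sum_insert ha, Finset.prod_insert ha]
    have h2 := ih (fun i hi => h0 i (Finset.mem_insert_of_mem hi))
    have ha0 := h0 a (Finset.mem_insert_self _ _)
    have h4 : 0 ≤ ∑ i ∈ s, x i := Finset.sum_nonneg fun i hi =>
      h0 i (Finset.mem_insert_of_mem hi)
    nlinarith

lemma aux_prod {d r : ℕ} (ε : ℝ) (hε : 0 < ε) (hr : 0 < r) (hr2 : 2 / ε ≤ (r : ℝ) + 1)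
    (l : Fin d → ℝ) (h0 : ∀ i, 0 < l i) (h1 : ∀ i, l i ≤ 1) (hl : ε < ∏ i, l i) :
    (∀ i, 0 ≤ ((r : ℝ) + 1) * l i - 1) ∧
      ε / 2 * (r : ℝ) ^ d ≤ ∏ i, (((r : ℝ) + 1) * l i - 1) := by
  have hrr : (0 : ℝ) < r := by exact_mod_cast hr
  have hpos : 0 < ∏ i, l i := hε.trans hl
  set x : Fin d → ℝ := fun i => (1 / l i - 1) / r with hx
  have hy0 : ∀ i, 0 ≤ 1 / l i - 1 := fun i => by
    rw [sub_nonneg, le_div_iff₀ (h0 i)]; linarith [h1 i]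
  have hx0 : ∀ i, 0 ≤ x i := fun i => div_nonneg (hy0 i) hrr.le
  have hs : ∑ i, x i ≤ 1 / 2 := by
    have h2 := aux_weier2 Finset.univ (fun i => 1 / l i - 1) (fun i _ => hy0 i)
    have h3 : ∏ i, (1 + (1 / l i - 1)) = 1 / ∏ i, l i := by
      simp
    rw [h3] at h2
    have h4 : 1 / ∏ i, l i ≤ 1 / ε := one_div_le_one_div_of_le hε hl.le
    have h5 : ∑ i, x i = (∑ i, (1 / l i - 1)) / r := by rw [hx, Finset.sum_div]
    rw [h5, div_le_iff₀ hrr]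
    have : 2 / ε = 2 * (1 / ε) := by ring
    linarith
  have hx1 : ∀ i, x i ≤ 1 / 2 := fun i =>
    (Finset.single_le_sum (fun j _ => hx0 j) (Finset.mem_univ i)).trans hs
  have key : ∀ i, ((r : ℝ) + 1) * l i - 1 = r * (l i * (1 - x i)) := fun i => by
    have := (h0 i).ne'
    simp only [hx]; field_simp; ring
  have hw := (aux_weier Finset.univ x (fun i _ => hx0 i) (fun i _ => by linarith [hx1 i])).1
  constructor
  · intro i
    rw [key]
    have := hx1 i
    exact mul_nonneg hrr.le (mul_nonneg (h0 i).le (by linarith))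
  · simp_rw [key]
    rw [Finset.prod_mul_distrib, Finset.prod_mul_distrib]
    simp only [Finset.prod_const, Finset.card_univ, Fintype.card_fin]
    have : ε / 2 ≤ (∏ i, l i) * ∏ i, (1 - x i) := by nlinarith
    nlinarith [pow_pos hrr d]

lemma aux_card (r : ℕ) (a b : ℝ) (ha : 0 ≤ a) (hb : b ≤ 1) :
    ((r : ℝ) + 1) * (b - a) - 1 ≤
      ((Finset.univ.filter fun k : Fin r => ⌈((r : ℝ) + 1) * a⌉₊ ≤ (k : ℕ) + 1 ∧
        (k : ℕ) + 1 < ⌈((r : ℝ) + 1) * b⌉₊).card : ℝ) := by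
  have hr : (0 : ℝ) ≤ r := Nat.cast_nonneg r
  set p := ⌈((r : ℝ) + 1) * a⌉₊ with hp
  set q := ⌈((r : ℝ) + 1) * b⌉₊ with hq
  have hq1 : q ≤ r + 1 := Nat.ceil_le.2 (by push_cast; nlinarith)
  have h1 : (Finset.Ico (max p 1) q).card ≤ (Finset.univ.filter fun k : Fin r =>
      p ≤ (k : ℕ) + 1 ∧ (k : ℕ) + 1 < q).card := by
    apply Finset.card_le_card_of_surjOn (fun k : Fin r => (k : ℕ) + 1)
    intro n hn
    simp only [Finset.coe_Ico, Set.mem_Ico, max_le_iff] at hn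
    refine ⟨⟨n - 1, by omega⟩, ?_, ?_⟩
    · simp; omega
    · simp; omega
  rw [Nat.card_Ico] at h1
  have h2 : q ≤ (Finset.univ.filter fun k : Fin r =>
      p ≤ (k : ℕ) + 1 ∧ (k : ℕ) + 1 < q).card + max p 1 := by omega
  have h3 : (q : ℝ) ≤ ((Finset.univ.filter fun k : Fin r =>
      p ≤ (k : ℕ) + 1 ∧ (k : ℕ) + 1 < q).card : ℝ) + max p 1 := by exact_mod_cast h2
  have h4 : ((r : ℝ) + 1) * b ≤ q := Nat.le_ceil _
  have h5 : (p : ℝ) < ((r : ℝ) + 1) * a + 1 := Nat.ceil_lt_add_one (by positivity)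
  push_cast at h3
  have h6 : max (p : ℝ) 1 ≤ ((r : ℝ) + 1) * a + 1 := max_le h5.le (by nlinarith)
  nlinarith

/-- Discrete sets cut out by `A` interval constraints. -/
def auxE (d r A : ℕ) (c : Fin A → Fin d × Fin (r + 2) × Fin (r + 2)) : Finset (Fin d → Fin r) :=
  Finset.univ.filter fun x => ∀ j, ((c j).2.1 : ℕ) ≤ (x (c j).1 : ℕ) + 1 ∧
    (x (c j).1 : ℕ) + 1 < ((c j).2.2 : ℕ)

lemma aux_cover {d A : ℕ} (hd : 0 < d) (S : Finset (Fin d)) (hS : S.card ≤ A) :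
    ∃ g : Fin A → Fin d, ∀ i ∈ S, ∃ j, g j = i := by
  classical
  refine ⟨fun j => if h : (j : ℕ) < S.card then (S.equivFin.symm ⟨j, h⟩ : Fin d) else ⟨0, hd⟩, ?_⟩
  intro i hi
  refine ⟨⟨S.equivFin ⟨i, hi⟩, lt_of_lt_of_le (Fin.is_lt _) hS⟩, ?_⟩
  simp

lemma aux_box {d r A : ℕ} (hd : 0 < d) (ε : ℝ) (hε : 0 < ε) (hr : 0 < r)
    (hr2 : 2 / ε ≤ (r : ℝ) + 1) (hA : A = ⌊((r : ℝ) + 1) * Real.log (1 / ε)⌋₊)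
    (a b : Fin d → ℝ) (hab : ∀ i, 0 ≤ a i ∧ a i ≤ b i ∧ b i ≤ 1) (hv : ε < ∏ i, (b i - a i)) :
    ∃ c, ε / 2 * (r : ℝ) ^ d ≤ ((auxE d r A c).card : ℝ) ∧
      ∀ x ∈ auxE d r A c, ∀ i, a i ≤ ((x i : ℕ) + 1 : ℝ) / ((r : ℝ) + 1) ∧
        ((x i : ℕ) + 1 : ℝ) / ((r : ℝ) + 1) < b i := by
  classical
  have hrr : (0 : ℝ) < (r : ℝ) + 1 := by positivity
  have hl0 : ∀ i, 0 < b i - a i := by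
    intro i
    rcases (sub_nonneg.2 (hab i).2.1).lt_or_eq with h | h
    · exact h
    · rw [Finset.prod_eq_zero (Finset.mem_univ i) h.symm] at hv; linarith
  have hl1 : ∀ i, b i - a i ≤ 1 := fun i => by linarith [hab i]
  let p : Fin d → ℕ := fun i => ⌈((r : ℝ) + 1) * a i⌉₊
  let q : Fin d → ℕ := fun i => ⌈((r : ℝ) + 1) * b i⌉₊
  have hp : ∀ i, p i < r + 2 := fun i => by
    have : p i ≤ r + 1 := Nat.ceil_le.2 (by push_cast; nlinarith [hab i])
    omega
  have hq : ∀ i, q i < r + 2 := fun i => by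
    have : q i ≤ r + 1 := Nat.ceil_le.2 (by push_cast; nlinarith [hab i])
    omega
  have hiff : ∀ i (k : ℕ), (p i ≤ k + 1 ∧ k + 1 < q i) ↔
      (a i ≤ ((k : ℝ) + 1) / ((r : ℝ) + 1) ∧ ((k : ℝ) + 1) / ((r : ℝ) + 1) < b i) := by
    intro i k
    simp only [p, q, Nat.ceil_le, Nat.lt_ceil, le_div_iff₀ hrr, div_lt_iff₀ hrr]
    push_cast
    rw [mul_comm (a i), mul_comm (b i)]
  let S : Finset (Fin d) := Finset.univ.filter fun i => b i - a i ≤ 1 - 1 / ((r : ℝ) + 1)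
  have hSc : S.card ≤ A := by
    rw [hA]
    apply Nat.le_floor
    have h1 : ∏ i, (b i - a i) ≤ ∏ i ∈ S, (b i - a i) := by
      rw [← Finset.prod_mul_prod_compl S]
      exact mul_le_of_le_one_right (Finset.prod_nonneg fun i _ => (hl0 i).le)
        (Finset.prod_le_one (fun i _ => (hl0 i).le) fun i _ => hl1 i)
    have h2 : ∏ i ∈ S, (b i - a i) ≤ ∏ _i ∈ S, Real.exp (-(1 / ((r : ℝ) + 1))) := by
      apply Finset.prod_le_prod (fun i _ => (hl0 i).le)
      intro i hi
      have h3 := (Finset.mem_filter.1 hi).2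
      have h4 := Real.add_one_le_exp (-(1 / ((r : ℝ) + 1)))
      linarith
    rw [Finset.prod_const, ← Real.exp_nat_mul] at h2
    have h5 : Real.log ε < S.card * (-(1 / ((r : ℝ) + 1))) := by
      rw [Real.log_lt_iff_lt_exp hε]; linarith
    have h6 : Real.log (1 / ε) = - Real.log ε := by rw [one_div, Real.log_inv]
    rw [h6]
    have h7 : (S.card : ℝ) * (-(1 / ((r : ℝ) + 1))) * ((r : ℝ) + 1) = - S.card := by
      field_simp
    nlinarith
  obtain ⟨g, hg⟩ := aux_cover hd S hSc
  have hfull : ∀ i, i ∉ S → ∀ k : Fin r, p i ≤ (k : ℕ) + 1 ∧ (k : ℕ) + 1 < q i := by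
    intro i hi k
    have h1 : 1 - 1 / ((r : ℝ) + 1) < b i - a i := by
      by_contra h
      exact hi (Finset.mem_filter.2 ⟨Finset.mem_univ _, not_lt.1 h⟩)
    have hk : ((k : ℕ) : ℝ) + 1 ≤ r := by exact_mod_cast k.2
    have hk0 : (0 : ℝ) ≤ ((k : ℕ) : ℝ) := Nat.cast_nonneg _
    have h2 : 1 / ((r : ℝ) + 1) ≤ (((k : ℕ) : ℝ) + 1) / ((r : ℝ) + 1) := by
      apply div_le_div_of_nonneg_right _ hrr.le; linarith
    have h3 : (((k : ℕ) : ℝ) + 1) / ((r : ℝ) + 1) ≤ 1 - 1 / ((r : ℝ) + 1) := by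
      rw [one_sub_div hrr.ne']
      apply div_le_div_of_nonneg_right _ hrr.le; linarith
    rw [hiff]
    constructor <;> linarith [hab i]
  have hmem : ∀ x, x ∈ auxE d r A (fun j => (g j, ⟨p (g j), hp _⟩, ⟨q (g j), hq _⟩)) ↔
      ∀ i, p i ≤ (x i : ℕ) + 1 ∧ (x i : ℕ) + 1 < q i := by
    intro x
    simp only [auxE, Finset.mem_filter, Finset.mem_univ, true_and]
    constructor
    · intro h i
      by_cases hi : i ∈ S
      · obtain ⟨j, rfl⟩ := hg i hi
        exact h j
      · exact hfull i hi _
    · intro h j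
      exact h _
  refine ⟨fun j => (g j, ⟨p (g j), hp _⟩, ⟨q (g j), hq _⟩), ?_, ?_⟩
  · have hE : auxE d r A (fun j => (g j, ⟨p (g j), hp _⟩, ⟨q (g j), hq _⟩)) =
        Fintype.piFinset fun i => Finset.univ.filter fun k : Fin r =>
          p i ≤ (k : ℕ) + 1 ∧ (k : ℕ) + 1 < q i := by
      ext x
      rw [hmem]
      simp
    rw [hE, Fintype.card_piFinset]
    push_cast
    obtain ⟨h1, h2⟩ := aux_prod ε hε hr hr2 (fun i => b i - a i) hl0 hl1 hv
    refine h2.trans (Finset.prod_le_prod (fun i _ => h1 i) fun i _ => ?_)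
    exact aux_card r (a i) (b i) (hab i).1 (hab i).2.2
  · intro x hx i
    exact (hiff i _).1 ((hmem x).1 hx i)

lemma aux_greedy {κ X : Type*} [DecidableEq κ] [DecidableEq X] [Fintype X] [Nonempty X]
    (F : Finset κ) (E : κ → Finset X) (p : ℝ) (hp1 : p ≤ 1)
    (hF : ∀ c ∈ F, p * Fintype.card X ≤ ((E c).card : ℝ)) (n : ℕ) :
    ∃ P : Finset X, P.card ≤ n ∧
      ((F.filter fun c => Disjoint (E c) P).card : ℝ) ≤ (1 - p) ^ n * F.card := by
  induction n with
  | zero => exact ⟨∅, by simp, by simp⟩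
  | succ n ih =>
    obtain ⟨P, hP, hc⟩ := ih
    set F' := F.filter fun c => Disjoint (E c) P with hF'
    have hsum : ∑ x : X, ((F'.filter fun c => x ∈ E c).card : ℝ) = ∑ c ∈ F', ((E c).card : ℝ) := by
      have : ∀ x : X, ((F'.filter fun c => x ∈ E c).card : ℝ) =
          ∑ c ∈ F', if x ∈ E c then (1 : ℝ) else 0 := fun x => by simp
      simp_rw [this]
      rw [Finset.sum_comm]
      refine Finset.sum_congr rfl fun c _ => ?_
      simp
    have hle : ∑ _x : X, p * (F'.card : ℝ) ≤ ∑ x : X, ((F'.filter fun c => x ∈ E c).card : ℝ) := by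
      rw [hsum]
      have : ∑ c ∈ F', p * (Fintype.card X : ℝ) ≤ ∑ c ∈ F', ((E c).card : ℝ) :=
        Finset.sum_le_sum fun c hc => hF c (Finset.mem_filter.1 hc).1
      refine le_trans (le_of_eq ?_) this
      simp; ring
    obtain ⟨x, _, hx⟩ := Finset.exists_le_of_sum_le Finset.univ_nonempty hle
    refine ⟨insert x P, (Finset.card_insert_le _ _).trans (by omega), ?_⟩
    have h1 : (F.filter fun c => Disjoint (E c) (insert x P)) =
        F'.filter fun c => ¬ x ∈ E c := by
      ext c
      simp only [hF', Finset.mem_filter, Finset.disjoint_insert_right]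
      tauto
    have h2 : ((F'.filter fun c => x ∈ E c).card : ℝ) + (F'.filter fun c => ¬ x ∈ E c).card =
        F'.card := by
      exact_mod_cast Finset.card_filter_add_card_filter_not (s := F') (fun c => x ∈ E c)
    rw [h1, pow_succ]
    nlinarith

lemma aux_Ninv {d r A n : ℕ} (hd : 0 < d) (ε : ℝ) (hε : 0 < ε) (hε1 : ε ≤ 1) (hr : 0 < r)
    (hr2 : 2 / ε ≤ (r : ℝ) + 1) (hA : A = ⌊((r : ℝ) + 1) * Real.log (1 / ε)⌋₊)
    (hn : (1 - ε / 2) ^ n * ((d * (r + 2) ^ 2 : ℕ) : ℝ) ^ A < 1) : Ninv ε d ≤ n := by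
  classical
  have : Nonempty (Fin r) := ⟨⟨0, hr⟩⟩
  let F : Finset (Fin A → Fin d × Fin (r + 2) × Fin (r + 2)) :=
    Finset.univ.filter fun c => ε / 2 * (r : ℝ) ^ d ≤ ((auxE d r A c).card : ℝ)
  obtain ⟨P, hP, hPc⟩ := aux_greedy F (auxE d r A) (ε / 2) (by linarith)
    (fun c hc => by simpa using (Finset.mem_filter.1 hc).2) n
  have hFc : (F.card : ℝ) ≤ ((d * (r + 2) ^ 2 : ℕ) : ℝ) ^ A := by
    have h := Finset.card_le_univ F
    have h2 : Fintype.card (Fin A → Fin d × Fin (r + 2) × Fin (r + 2)) =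
        (d * (r + 2) ^ 2) ^ A := by
      simp [sq]
    rw [h2] at h
    exact_mod_cast h
  have hlt : ((F.filter fun c => Disjoint (auxE d r A c) P).card : ℝ) < 1 := by
    refine hPc.trans_lt (lt_of_le_of_lt ?_ hn)
    exact mul_le_mul_of_nonneg_left hFc (pow_nonneg (by linarith) _)
  have h0 : F.filter (fun c => Disjoint (auxE d r A c) P) = ∅ := by
    rw [← Finset.card_eq_zero]
    have : (F.filter fun c => Disjoint (auxE d r A c) P).card < 1 := by exact_mod_cast hlt
    omega
  let φ : (Fin d → Fin r) → (Fin d → ℝ) := fun x i => ((x i : ℕ) + 1 : ℝ) / ((r : ℝ) + 1)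
  let Q : Finset (Fin d → ℝ) := P.image φ
  have hrr : (0 : ℝ) < (r : ℝ) + 1 := by positivity
  have hQc : (Q : Set (Fin d → ℝ)) ⊆ cube d := by
    intro y hy
    simp only [Q, Finset.coe_image, Set.mem_image] at hy
    obtain ⟨x, _, rfl⟩ := hy
    intro i _
    refine ⟨by positivity, ?_⟩
    have : ((x i : ℕ) : ℝ) + 1 ≤ r := by exact_mod_cast (x i).2
    rw [div_le_one hrr]; linarith
  have hdisp : disp (Q : Set (Fin d → ℝ)) ≤ ε := by
    apply Real.sSup_le _ hε.le
    rintro v ⟨B, ⟨a, b, hab, rfl⟩, hB, rfl⟩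
    rw [Real.volume_pi_Ico_toReal (fun i => (hab i).2.1)]
    by_contra hv
    obtain ⟨c, hc1, hc2⟩ := aux_box hd ε hε hr hr2 hA a b hab (not_le.1 hv)
    have hcF : c ∈ F := Finset.mem_filter.2 ⟨Finset.mem_univ _, hc1⟩
    have hnd : ¬ Disjoint (auxE d r A c) P := fun h => by
      have : c ∈ F.filter fun c => Disjoint (auxE d r A c) P := Finset.mem_filter.2 ⟨hcF, h⟩
      rw [h0] at this
      simp at this
    obtain ⟨x, hx1, hx2⟩ := Finset.not_disjoint_iff.1 hnd
    have : φ x ∈ (Set.univ.pi fun i => Set.Ico (a i) (b i)) ∩ (Q : Set (Fin d → ℝ)) :=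
      ⟨fun i _ => hc2 x hx1 i, by simpa [Q] using ⟨x, hx2, rfl⟩⟩
    rw [hB] at this
    exact this
  have hmin : minDisp Q.card d ≤ ε := by
    refine le_trans (csInf_le ⟨0, ?_⟩ ⟨Q, hQc, rfl, rfl⟩) hdisp
    rintro v ⟨P', _, _, rfl⟩
    apply Real.sSup_nonneg
    rintro v ⟨B, _, _, rfl⟩
    exact ENNReal.toReal_nonneg
  calc Ninv ε d ≤ Q.card := Nat.sInf_le hmin
    _ ≤ P.card := Finset.card_image_le
    _ ≤ n := hP

/-- There exists an absolute constant `C ≥ 1` such that for every integer `d ≥ 2` and every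
`ε ∈ (0, 1/2]` with `ε ≥ (ln d)/d`, one has `N(ε,d) ≤ (C ln d / ε²) · ln(1/ε)`. -/
theorem minimal_dispersion_inverse_bound_very_large_eps :
    ∃ C : ℝ, 1 ≤ C ∧ ∀ d : ℕ, 2 ≤ d → ∀ ε : ℝ, 0 < ε → ε ≤ 1 / 2 →
      Real.log d / d ≤ ε →
      (Ninv ε d : ℝ) ≤ C * Real.log d / ε ^ 2 * Real.log (1 / ε) := by
  refine ⟨55, by norm_num, ?_⟩
  intro d hd ε hε hε2 hεd
  have hd2 : (2 : ℝ) ≤ d := by exact_mod_cast hd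
  have hl2 := Real.log_two_gt_d9
  have hLd : 0.69 ≤ Real.log d := by
    have := Real.log_le_log (by norm_num) hd2
    linarith
  have hinv : 2 ≤ 1 / ε := by rw [le_div_iff₀ hε]; linarith
  have hLe : 0.69 ≤ Real.log (1 / ε) := by
    have := Real.log_le_log (by norm_num) hinv
    linarith
  obtain ⟨r, hr⟩ : ∃ r, ⌈2 / ε⌉₊ = r + 1 :=
    Nat.exists_eq_succ_of_ne_zero (Nat.ceil_pos.2 (by positivity)).ne'
  have h2e : 2 / ε = 2 * (1 / ε) := by ring
  have hr2 : 2 / ε ≤ (r : ℝ) + 1 := by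
    have := Nat.le_ceil (2 / ε)
    rw [hr] at this
    exact_mod_cast this
  have hr3 : (r : ℝ) ≤ 2 / ε := by
    have := Nat.ceil_lt_add_one (a := 2 / ε) (by positivity)
    rw [hr] at this
    push_cast at this
    linarith
  have hr0 : 0 < r := by
    have : (0 : ℝ) < r := by linarith
    exact_mod_cast this
  set A := ⌊((r : ℝ) + 1) * Real.log (1 / ε)⌋₊ with hA
  have hAle : (A : ℝ) ≤ 3 * (1 / ε) * Real.log (1 / ε) := by
    refine (Nat.floor_le (by positivity)).trans ?_
    apply mul_le_mul_of_nonneg_right _ (by linarith)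
    linarith
  -- size of the family
  have h1e : 1 / ε ≤ 1.5 * d := by
    rw [div_le_iff₀ hε]
    rw [div_le_iff₀ (by linarith)] at hεd
    nlinarith
  have hrd : (r : ℝ) + 2 ≤ (d : ℝ) ^ 4 := by
    have h8 : (2 : ℝ) ^ 3 ≤ (d : ℝ) ^ 3 := pow_le_pow_left₀ (by norm_num) hd2 3
    have : (r : ℝ) + 2 ≤ 4.5 * d := by linarith
    nlinarith
  have hK : ((d * (r + 2) ^ 2 : ℕ) : ℝ) ≤ (d : ℝ) ^ 9 := by
    push_cast
    calc (d : ℝ) * ((r : ℝ) + 2) ^ 2 ≤ d * ((d : ℝ) ^ 4) ^ 2 := by gcongr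
      _ = (d : ℝ) ^ 9 := by ring
  have hKe : (d : ℝ) ^ 9 = Real.exp (9 * Real.log d) := by
    rw [← Real.exp_log (show (0 : ℝ) < d by linarith), ← Real.exp_nat_mul, Real.log_exp]
    norm_num
  set Y : ℝ := 2 / ε * (A * (9 * Real.log d)) with hY
  have hY0 : 0 ≤ Y := by positivity
  set n := ⌊Y⌋₊ + 1 with hn
  have hYn : Y < n := by rw [hn]; push_cast; exact Nat.lt_floor_add_one Y
  have hnY : (n : ℝ) ≤ Y + 1 := by
    rw [hn]; push_cast; linarith [Nat.floor_le hY0]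
  have hbound : (1 - ε / 2) ^ n * ((d * (r + 2) ^ 2 : ℕ) : ℝ) ^ A < 1 := by
    have h1 : (1 - ε / 2) ^ n ≤ Real.exp (n * (-(ε / 2))) := by
      rw [Real.exp_nat_mul]
      apply pow_le_pow_left₀ (by linarith)
      linarith [Real.add_one_le_exp (-(ε / 2))]
    have h2 : ((d * (r + 2) ^ 2 : ℕ) : ℝ) ^ A ≤ Real.exp (A * (9 * Real.log d)) := by
      rw [Real.exp_nat_mul, ← hKe]
      exact pow_le_pow_left₀ (Nat.cast_nonneg _) hK _
    calc (1 - ε / 2) ^ n * ((d * (r + 2) ^ 2 : ℕ) : ℝ) ^ A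
        ≤ Real.exp (n * (-(ε / 2))) * Real.exp (A * (9 * Real.log d)) := by
          apply mul_le_mul h1 h2 (by positivity) (Real.exp_nonneg _)
      _ = Real.exp (n * (-(ε / 2)) + A * (9 * Real.log d)) := by rw [Real.exp_add]
      _ < 1 := by
          rw [Real.exp_lt_one_iff]
          have h3 : Y * (ε / 2) = A * (9 * Real.log d) := by rw [hY]; field_simp
          have h4 := mul_lt_mul_of_pos_right hYn (show 0 < ε / 2 by linarith)
          linarith
  have hfin := aux_Ninv (by omega) ε hε (by linarith) hr0 hr2 hA hbound
  have hfin' : (Ninv ε d : ℝ) ≤ n := by exact_mod_cast hfin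
  set X : ℝ := Real.log d / ε ^ 2 * Real.log (1 / ε) with hX
  have hYX : Y ≤ 54 * X := by
    have h5 : Y ≤ 2 / ε * ((3 * (1 / ε) * Real.log (1 / ε)) * (9 * Real.log d)) := by
      rw [hY]
      gcongr
    refine h5.trans (le_of_eq ?_)
    rw [hX]
    field_simp
    ring
  have hX1 : 1 ≤ X := by
    have h6 : X = (1 / ε) ^ 2 * (Real.log d * Real.log (1 / ε)) := by rw [hX]; field_simp
    rw [h6]
    have h7 : (4 : ℝ) ≤ (1 / ε) ^ 2 := by nlinarith
    have h8 : (0.4 : ℝ) ≤ Real.log d * Real.log (1 / ε) := by nlinarith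
    nlinarith
  have h9 : 55 * Real.log d / ε ^ 2 * Real.log (1 / ε) = 55 * X := by rw [hX]; ring
  rw [h9]
  linarith
end
end
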